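/- There exist absolute constants C > 0 and N₀ ≥ 1 with the following property. Let u : ℝ² → ℝ be smooth with compact support contained in {(t,x) : t > 0, x > 0, and t ≤ x²}, let N ≥ N₀ be real, and define h(t,x) = (1/t)·( t·∂_t u + N·u − t·∂²_x u )(t,x) on {t > 0}. Then ∬ [ t·(∂_t u)² + t·(∂²_x u)² + (N + x²/t)·(∂_x u)² + (N·x²/t² + N²/t)·u² ] dt dx ≤ C·∬ x²·h² dt dx, where all integrals are over (0,∞)×(0,∞). -/

import Mathlib

open Set MeasureTheory

/-- Partial derivative in the first variable. -/
noncomputable def pd1 (u : ℝ × ℝ → ℝ) (p : ℝ × ℝ) : ℝ :=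
  deriv (fun t => u (t, p.2)) p.1

/-- Partial derivative in the second variable. -/
noncomputable def pd2 (u : ℝ × ℝ → ℝ) (p : ℝ × ℝ) : ℝ :=
  deriv (fun s => u (p.1, s)) p.2

lemma hasDerivAt_pd1 {f : ℝ × ℝ → ℝ} (hf : Differentiable ℝ f) (p : ℝ × ℝ) :
    HasDerivAt (fun t => f (t, p.2)) (pd1 f p) p.1 :=
  DifferentiableAt.hasDerivAt (by fun_prop)

lemma hasDerivAt_pd2 {f : ℝ × ℝ → ℝ} (hf : Differentiable ℝ f) (p : ℝ × ℝ) :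
    HasDerivAt (fun s => f (p.1, s)) (pd2 f p) p.2 :=
  DifferentiableAt.hasDerivAt (by fun_prop)

lemma pd1_eq_fderiv {f : ℝ × ℝ → ℝ} (hf : Differentiable ℝ f) :
    pd1 f = fun p => fderiv ℝ f p (1, 0) := by
  funext p
  have h : HasDerivAt (fun t : ℝ => ((t, p.2) : ℝ × ℝ)) (1, 0) p.1 :=
    (hasDerivAt_id p.1).prodMk (hasDerivAt_const p.1 p.2)
  exact ((hf p).hasFDerivAt.comp_hasDerivAt p.1 h).deriv

lemma pd2_eq_fderiv {f : ℝ × ℝ → ℝ} (hf : Differentiable ℝ f) :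
    pd2 f = fun p => fderiv ℝ f p (0, 1) := by
  funext p
  have h : HasDerivAt (fun s : ℝ => ((p.1, s) : ℝ × ℝ)) (0, 1) p.2 :=
    (hasDerivAt_const p.2 p.1).prodMk (hasDerivAt_id p.2)
  exact ((hf p).hasFDerivAt.comp_hasDerivAt p.2 h).deriv

lemma contDiff_pd1 {f : ℝ × ℝ → ℝ} (hf : ContDiff ℝ (⊤ : ℕ∞) f) :
    ContDiff ℝ (⊤ : ℕ∞) (pd1 f) := by
  rw [pd1_eq_fderiv (hf.differentiable (by simp))]
  exact (hf.fderiv_right (by simp)).clm_apply contDiff_const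

lemma contDiff_pd2 {f : ℝ × ℝ → ℝ} (hf : ContDiff ℝ (⊤ : ℕ∞) f) :
    ContDiff ℝ (⊤ : ℕ∞) (pd2 f) := by
  rw [pd2_eq_fderiv (hf.differentiable (by simp))]
  exact (hf.fderiv_right (by simp)).clm_apply contDiff_const

lemma tsupport_pd1_subset {f : ℝ × ℝ → ℝ} (hf : Differentiable ℝ f) :
    tsupport (pd1 f) ⊆ tsupport f := by
  rw [pd1_eq_fderiv hf]
  exact tsupport_fderiv_apply_subset ℝ _

lemma tsupport_pd2_subset {f : ℝ × ℝ → ℝ} (hf : Differentiable ℝ f) :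
    tsupport (pd2 f) ⊆ tsupport f := by
  rw [pd2_eq_fderiv hf]
  exact tsupport_fderiv_apply_subset ℝ _

lemma pd1_pd2_comm {f : ℝ × ℝ → ℝ} (hf : ContDiff ℝ (⊤ : ℕ∞) f) :
    pd1 (pd2 f) = pd2 (pd1 f) := by
  have hd : Differentiable ℝ f := hf.differentiable (by simp)
  have hd' : Differentiable ℝ (fderiv ℝ f) :=
    (hf.fderiv_right (m := (⊤ : ℕ∞)) (by simp)).differentiable (by simp)
  rw [pd1_eq_fderiv ((contDiff_pd2 hf).differentiable (by simp)),
    pd2_eq_fderiv ((contDiff_pd1 hf).differentiable (by simp)),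
    pd1_eq_fderiv hd, pd2_eq_fderiv hd]
  funext p
  rw [fderiv_clm_apply (hd' p) (by fun_prop), fderiv_clm_apply (hd' p) (by fun_prop)]
  simpa using second_derivative_symmetric (fun y => (hd y).hasFDerivAt) (hd' p).hasFDerivAt
    (1, 0) (0, 1)

/-- The integral of a directional derivative of a compactly supported function vanishes. -/
lemma integrable_and_integral_fderiv_apply_eq_zero {f : ℝ × ℝ → ℝ} (hf : ContDiff ℝ (⊤ : ℕ∞) f)
    (hc : HasCompactSupport f) (v : ℝ × ℝ) :
    Integrable (fun p => fderiv ℝ f p v) ∧ ∫ p, fderiv ℝ f p v = 0 := by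
  have hi : Integrable (fun p => fderiv ℝ f p v) :=
    ((hf.continuous_fderiv (by simp)).clm_apply continuous_const).integrable_of_hasCompactSupport
      (hc.fderiv_apply ℝ v)
  refine ⟨hi, ?_⟩
  have := integral_mul_fderiv_eq_neg_fderiv_mul_of_integrable (μ := (volume : Measure (ℝ × ℝ)))
    (f := fun _ => (1 : ℝ)) (g := f) (v := v) (by simp) (by simpa using hi)
    (by simpa using hf.continuous.integrable_of_hasCompactSupport hc)
    (fun _ _ => by fun_prop) (fun x _ => hf.differentiable (by simp) x)
  simpa using this

/-- A smooth function supported away from `t = 0` is `t` times a smooth function. -/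
lemma exists_contDiff_eq_fst_mul {u : ℝ × ℝ → ℝ} (hu : ContDiff ℝ (⊤ : ℕ∞) u)
    (h0 : ∀ p ∈ tsupport u, p.1 ≠ 0) :
    ∃ v : ℝ × ℝ → ℝ, ContDiff ℝ (⊤ : ℕ∞) v ∧ tsupport v ⊆ tsupport u ∧
      u = fun p => p.1 * v p := by
  refine ⟨fun p => u p * p.1⁻¹, contDiff_iff_contDiffAt.2 fun p => ?_, tsupport_mul_subset_left,
    ?_⟩
  · by_cases hp : p ∈ tsupport u
    · exact hu.contDiffAt.mul (contDiffAt_fst.inv (h0 p hp))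
    · have h : (fun p => u p * p.1⁻¹) =ᶠ[nhds p] fun _ => (0 : ℝ) := by
        filter_upwards [notMem_tsupport_iff_eventuallyEq.1 hp] with q hq
        simp [hq]
      exact contDiffAt_const.congr_of_eventuallyEq h
  · funext p
    by_cases hp : p ∈ tsupport u
    · have := h0 p hp
      field_simp
    · simp [image_eq_zero_of_notMem_tsupport hp]

/-- The algebraic inequality behind the energy estimate: `a, b, c, d` stand for
`v, ∂_t v, ∂_x v, ∂²_x v` and `m` for the mixed derivative, where `u = t v`. -/
lemma energy_density_le {N t x a b c d m : ℝ} (hN : 2 ≤ N) (ht : 0 < t) (htx : t ≤ x ^ 2) :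
    (t * (a + t * b) ^ 2 + t * (t * d) ^ 2 + (N * t ^ 2 + x ^ 2 * t) * c ^ 2 +
        (N * x ^ 2 + N ^ 2 * t) * a ^ 2) +
      (x ^ 2 * (a ^ 2 + 2 * t * a * b) + 3 * N * (2 * t * a ^ 2 + 2 * t ^ 2 * a * b) +
        (3 * t ^ 2 * c ^ 2 + 2 * t ^ 3 * c * m)) +
      (-2 * t * (2 * x * a * c + x ^ 2 * c ^ 2 + x ^ 2 * a * d) + 2 * t * (a ^ 2 + 2 * x * a * c) -
        6 * N * t ^ 2 * (c ^ 2 + a * d) - 2 * t ^ 2 * ((c + t * m) * c + (a + t * b) * d)) ≤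
    6 * (x ^ 2 * (a + t * b + N * a - t * d) ^ 2) := by
  obtain ⟨k, hk⟩ : ∃ k, k = a + t * b + N * a - t * d := ⟨_, rfl⟩
  have h1 : 0 ≤ x ^ 2 * (k - a) ^ 2 := by positivity
  have h3 : 0 ≤ t * (k + N * a) ^ 2 := by positivity
  have h8 : 0 ≤ t ^ 2 * c ^ 2 := by positivity
  have h9 : 0 ≤ x ^ 2 * a ^ 2 := by positivity
  have h10 : 0 ≤ x ^ 2 * t * c ^ 2 := by positivity
  rw [← hk]
  have key : (t * (a + t * b) ^ 2 + t * (t * d) ^ 2 + (N * t ^ 2 + x ^ 2 * t) * c ^ 2 +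
        (N * x ^ 2 + N ^ 2 * t) * a ^ 2) +
      (x ^ 2 * (a ^ 2 + 2 * t * a * b) + 3 * N * (2 * t * a ^ 2 + 2 * t ^ 2 * a * b) +
        (3 * t ^ 2 * c ^ 2 + 2 * t ^ 3 * c * m)) +
      (-2 * t * (2 * x * a * c + x ^ 2 * c ^ 2 + x ^ 2 * a * d) + 2 * t * (a ^ 2 + 2 * x * a * c) -
        6 * N * t ^ 2 * (c ^ 2 + a * d) - 2 * t ^ 2 * ((c + t * m) * c + (a + t * b) * d)) =
      t * (k - N * a) ^ 2 + 2 * x ^ 2 * k * a + 6 * N * t * k * a + (1 - 5 * N) * t ^ 2 * c ^ 2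
        - x ^ 2 * t * c ^ 2 - (N + 1) * x ^ 2 * a ^ 2 - 5 * N ^ 2 * t * a ^ 2 + 2 * t * a ^ 2 := by
    subst hk
    ring
  rw [key]
  nlinarith

lemma energy_estimate {v : ℝ × ℝ → ℝ} {N : ℝ} (hN : 2 ≤ N) (hv : ContDiff ℝ (⊤ : ℕ∞) v)
    (hc : HasCompactSupport v) (hs : ∀ p ∈ tsupport v, 0 < p.1 ∧ p.1 ≤ p.2 ^ 2) :
    ∫ p : ℝ × ℝ, (p.1 * (v p + p.1 * pd1 v p) ^ 2 + p.1 * (p.1 * pd2 (pd2 v) p) ^ 2 +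
        (N * p.1 ^ 2 + p.2 ^ 2 * p.1) * (pd2 v p) ^ 2 +
        (N * p.2 ^ 2 + N ^ 2 * p.1) * (v p) ^ 2) ≤
      6 * ∫ p : ℝ × ℝ, p.2 ^ 2 * (v p + p.1 * pd1 v p + N * v p - p.1 * pd2 (pd2 v) p) ^ 2 := by
  have hd := hv.differentiable (by simp)
  have hv1 := contDiff_pd1 hv
  have hv2 := contDiff_pd2 hv
  have hv22 := contDiff_pd2 hv2
  have hd1 := hv1.differentiable (by simp)
  have hd2 := hv2.differentiable (by simp)
  have c0 := hv.continuous
  have c1 := hv1.continuous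
  have c2 := hv2.continuous
  have c22 := hv22.continuous
  have z0 {p} (hp : p ∉ tsupport v) : v p = 0 := image_eq_zero_of_notMem_tsupport hp
  have z1 {p} (hp : p ∉ tsupport v) : pd1 v p = 0 :=
    image_eq_zero_of_notMem_tsupport fun h => hp (tsupport_pd1_subset hd h)
  have z2 {p} (hp : p ∉ tsupport v) : pd2 v p = 0 :=
    image_eq_zero_of_notMem_tsupport fun h => hp (tsupport_pd2_subset hd h)
  have z22 {p} (hp : p ∉ tsupport v) : pd2 (pd2 v) p = 0 :=
    image_eq_zero_of_notMem_tsupport fun h =>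
      hp (tsupport_pd2_subset hd (tsupport_pd2_subset hd2 h))
  set F : ℝ × ℝ → ℝ := fun p => p.2 ^ 2 * (p.1 * v p ^ 2) + 3 * N * (p.1 ^ 2 * v p ^ 2) +
    p.1 ^ 3 * pd2 v p ^ 2 with hF
  set G : ℝ × ℝ → ℝ := fun p => -2 * p.1 * (p.2 ^ 2 * v p * pd2 v p) +
    2 * p.1 * (p.2 * v p ^ 2) - 6 * N * p.1 ^ 2 * (v p * pd2 v p) -
    2 * p.1 ^ 2 * ((v p + p.1 * pd1 v p) * pd2 v p) with hG
  have sF : ContDiff ℝ (⊤ : ℕ∞) F := by fun_prop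
  have sG : ContDiff ℝ (⊤ : ℕ∞) G := by fun_prop
  have cF : HasCompactSupport F := .intro hc fun p hp => by simp [hF, z0 hp, z2 hp]
  have cG : HasCompactSupport G := .intro hc fun p hp => by simp [hG, z0 hp, z2 hp]
  obtain ⟨iF, eF⟩ := integrable_and_integral_fderiv_apply_eq_zero sF cF (1, 0)
  obtain ⟨iG, eG⟩ := integrable_and_integral_fderiv_apply_eq_zero sG cG (0, 1)
  rw [← pd1_eq_fderiv (sF.differentiable (by simp))] at iF eF
  rw [← pd2_eq_fderiv (sG.differentiable (by simp))] at iG eG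
  have dF (p : ℝ × ℝ) : pd1 F p = p.2 ^ 2 * (v p ^ 2 + 2 * p.1 * v p * pd1 v p) +
      3 * N * (2 * p.1 * v p ^ 2 + 2 * p.1 ^ 2 * v p * pd1 v p) +
      (3 * p.1 ^ 2 * pd2 v p ^ 2 + 2 * p.1 ^ 3 * pd2 v p * pd2 (pd1 v) p) := by
    have e0 := hasDerivAt_pd1 hd p
    have e2 := hasDerivAt_pd1 hd2 p
    rw [pd1_pd2_comm hv] at e2
    have t := hasDerivAt_id p.1
    have := (((t.mul (e0.pow 2)).const_mul (p.2 ^ 2)).add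
      (((t.pow 2).mul (e0.pow 2)).const_mul (3 * N))).add ((t.pow 3).mul (e2.pow 2))
    refine this.deriv.trans ?_
    simp
    ring
  have dG (p : ℝ × ℝ) : pd2 G p = -2 * p.1 * (2 * p.2 * v p * pd2 v p + p.2 ^ 2 * pd2 v p ^ 2 +
        p.2 ^ 2 * v p * pd2 (pd2 v) p) + 2 * p.1 * (v p ^ 2 + 2 * p.2 * v p * pd2 v p) -
      6 * N * p.1 ^ 2 * (pd2 v p ^ 2 + v p * pd2 (pd2 v) p) -
      2 * p.1 ^ 2 * ((pd2 v p + p.1 * pd2 (pd1 v) p) * pd2 v p +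
        (v p + p.1 * pd1 v p) * pd2 (pd2 v) p) := by
    have e0 := hasDerivAt_pd2 hd p
    have e1 := hasDerivAt_pd2 hd1 p
    have e2 := hasDerivAt_pd2 hd2 p
    have s := hasDerivAt_id p.2
    have := ((((((s.pow 2).mul e0).mul e2).const_mul (-2 * p.1)).add
      ((s.mul (e0.pow 2)).const_mul (2 * p.1))).sub
      ((e0.mul e2).const_mul (6 * N * p.1 ^ 2))).sub
      (((e0.add (e1.const_mul p.1)).mul e2).const_mul (2 * p.1 ^ 2))
    refine this.deriv.trans ?_
    simp
    ring
  set A : ℝ × ℝ → ℝ := fun p =>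
    p.1 * (v p + p.1 * pd1 v p) ^ 2 + p.1 * (p.1 * pd2 (pd2 v) p) ^ 2 +
      (N * p.1 ^ 2 + p.2 ^ 2 * p.1) * (pd2 v p) ^ 2 +
      (N * p.2 ^ 2 + N ^ 2 * p.1) * (v p) ^ 2 with hA
  set B : ℝ × ℝ → ℝ := fun p =>
    p.2 ^ 2 * (v p + p.1 * pd1 v p + N * v p - p.1 * pd2 (pd2 v) p) ^ 2 with hB
  have iA : Integrable A := Continuous.integrable_of_hasCompactSupport (by fun_prop)
    (.intro hc fun p hp => by simp [hA, z0 hp, z1 hp, z2 hp, z22 hp])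
  have iB : Integrable B := Continuous.integrable_of_hasCompactSupport (by fun_prop)
    (.intro hc fun p hp => by simp [hB, z0 hp, z1 hp, z22 hp])
  have hle : ∫ p, (A p + pd1 F p + pd2 G p) ≤ ∫ p, 6 * B p := by
    refine integral_mono ((iA.add iF).add iG) (iB.const_mul 6) fun p => ?_
    by_cases hp : p ∈ tsupport v
    · simp only [dF, dG, hA, hB]
      exact energy_density_le hN (hs p hp).1 (hs p hp).2
    · simp [dF, dG, hA, hB, z0 hp, z1 hp, z2 hp, z22 hp]
  rwa [integral_add (by exact iA.add iF) iG, integral_add iA iF, eF, eG, add_zero, add_zero,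
    integral_const_mul] at hle

/-- A priori estimate for the conjugated model heat operator `t∂_t + N − t∂²_x` in the
coordinates `(t,x)` for functions supported in the parabolic region `t ≤ x²`:
with `h = t^{−1}(t∂_t u + Nu − t∂²_x u)`,
`∬ t(∂_t u)² + t(∂²_x u)² + (N + x²/t)(∂_x u)² + (Nx²/t² + N²/t)u² ≤ C ∬ x²h²`. -/
theorem model_estimate_corner :
    ∃ C : ℝ, 0 < C ∧ ∃ N₀ : ℝ, 1 ≤ N₀ ∧
      ∀ (u h : ℝ × ℝ → ℝ) (N : ℝ), N₀ ≤ N →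
        ContDiff ℝ (⊤ : ℕ∞) u → HasCompactSupport u →
        tsupport u ⊆ {p : ℝ × ℝ | 0 < p.1 ∧ 0 < p.2 ∧ p.1 ≤ p.2 ^ 2} →
        (∀ p : ℝ × ℝ, 0 < p.1 →
          h p = (1 / p.1) *
            (p.1 * pd1 u p + N * u p - p.1 * pd2 (pd2 u) p)) →
        (∫ p in Ioi (0:ℝ) ×ˢ Ioi (0:ℝ),
            (p.1 * (pd1 u p) ^ 2 + p.1 * (pd2 (pd2 u) p) ^ 2 +
              (N + p.2 ^ 2 / p.1) * (pd2 u p) ^ 2 +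
              (N * p.2 ^ 2 / p.1 ^ 2 + N ^ 2 / p.1) * (u p) ^ 2)) ≤
          C * ∫ p in Ioi (0:ℝ) ×ˢ Ioi (0:ℝ), p.2 ^ 2 * (h p) ^ 2 := by
  refine ⟨6, by norm_num, 2, by norm_num, fun u h N hN hu hcu hsu hh => ?_⟩
  obtain ⟨v, hv, hvu, rfl⟩ := exists_contDiff_eq_fst_mul hu fun p hp => (hsu hp).1.ne'
  have hc : HasCompactSupport v := hcu.mono' (subset_closure.trans hvu)
  have hd := hv.differentiable (by simp)
  have hd2 := (contDiff_pd2 hv).differentiable (by simp)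
  have u1 : pd1 (fun p => p.1 * v p) = fun p => v p + p.1 * pd1 v p := by
    funext p
    exact ((hasDerivAt_id p.1).mul (hasDerivAt_pd1 hd p)).deriv.trans (by simp)
  have u2 : pd2 (fun p => p.1 * v p) = fun p => p.1 * pd2 v p := by
    funext p
    exact ((hasDerivAt_pd2 hd p).const_mul p.1).deriv
  have u22 : pd2 (fun p => p.1 * pd2 v p) = fun p => p.1 * pd2 (pd2 v) p := by
    funext p
    exact ((hasDerivAt_pd2 hd2 p).const_mul p.1).deriv
  have hout {p : ℝ × ℝ} (hp : p ∉ Ioi (0 : ℝ) ×ˢ Ioi (0 : ℝ)) : p ∉ tsupport v := fun hm =>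
    hp ⟨(hsu (hvu hm)).1, (hsu (hvu hm)).2.1⟩
  have z0 {p} (hp : p ∉ tsupport v) : v p = 0 := image_eq_zero_of_notMem_tsupport hp
  have z1 {p} (hp : p ∉ tsupport v) : pd1 v p = 0 :=
    image_eq_zero_of_notMem_tsupport fun h => hp (tsupport_pd1_subset hd h)
  have z2 {p} (hp : p ∉ tsupport v) : pd2 v p = 0 :=
    image_eq_zero_of_notMem_tsupport fun h => hp (tsupport_pd2_subset hd h)
  have z22 {p} (hp : p ∉ tsupport v) : pd2 (pd2 v) p = 0 :=
    image_eq_zero_of_notMem_tsupport fun h =>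
      hp (tsupport_pd2_subset hd (tsupport_pd2_subset hd2 h))
  have key := energy_estimate hN hv hc fun p hp => ⟨(hsu (hvu hp)).1, (hsu (hvu hp)).2.2⟩
  have hQ : MeasurableSet (Ioi (0 : ℝ) ×ˢ Ioi (0 : ℝ)) := measurableSet_Ioi.prod measurableSet_Ioi
  rw [← setIntegral_eq_integral_of_forall_compl_eq_zero (μ := volume)
      (s := Ioi (0 : ℝ) ×ˢ Ioi (0 : ℝ))
      fun p hp => by simp [z0 (hout hp), z1 (hout hp), z2 (hout hp), z22 (hout hp)],
    ← setIntegral_eq_integral_of_forall_compl_eq_zero (μ := volume)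
      (s := Ioi (0 : ℝ) ×ˢ Ioi (0 : ℝ))
      fun p hp => by simp [z0 (hout hp), z1 (hout hp), z22 (hout hp)]] at key
  convert key using 1
  · refine setIntegral_congr_fun hQ fun p hp => ?_
    have hp1 : p.1 ≠ 0 := (mem_Ioi.1 hp.1).ne'
    simp only [u1, u2, u22]
    field_simp
  · congr 1
    refine setIntegral_congr_fun hQ fun p hp => ?_
    have hp1 : p.1 ≠ 0 := (mem_Ioi.1 hp.1).ne'
    simp only [hh p hp.1, u1, u2, u22]
    field_simp
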